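/- Let P ⊆ ℝ^d be a polytope such that both P and its dual P* are semi-reflexive (in particular both are bounded rational polytopes satisfying L(s) = L(⌊s⌋)). Then P is reflexive: both P and P* are integer polytopes. -/

import Mathlib

open Pointwise

noncomputable def latticeCount {d : ℕ} (S : Set (Fin d → ℝ)) : ℕ :=
  Set.ncard {x : Fin d → ℤ | (fun i => (x i : ℝ)) ∈ S}

/-- The polar dual of a set, with respect to the standard inner product. -/
def polarDual {d : ℕ} (P : Set (Fin d → ℝ)) : Set (Fin d → ℝ) :=
  {x : Fin d → ℝ | ∀ y ∈ P, ∑ i, x i * y i ≤ 1}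

/-- A continuous linear functional on `ℝ^d` is the pairing with a vector. -/
theorem exists_dot_eq {d : ℕ} (f : StrongDual ℝ (Fin d → ℝ)) :
    ∃ a : Fin d → ℝ, ∀ y, f y = ∑ i, a i * y i := by
  refine ⟨fun i => f (fun j => if i = j then 1 else 0), fun y => ?_⟩
  have h := LinearMap.pi_apply_eq_sum_univ (f : (Fin d → ℝ) →ₗ[ℝ] ℝ) y
  simp only [ContinuousLinearMap.coe_coe, smul_eq_mul] at h
  rw [h]
  exact Finset.sum_congr rfl fun i _ => mul_comm _ _

theorem eq_zero_of_forall_nat_smul_mem {d : ℕ} {K : Set (Fin d → ℝ)}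
    (hK : Bornology.IsBounded K) {x : Fin d → ℝ} (hx : ∀ n : ℕ, (n : ℝ) • x ∈ K) : x = 0 := by
  obtain ⟨C, hC⟩ := hK.exists_norm_le
  by_contra h0
  have hpos : 0 < ‖x‖ := norm_pos_iff.mpr h0
  obtain ⟨n, hn⟩ := exists_nat_gt (C / ‖x‖)
  have h := hC _ (hx n)
  rw [norm_smul, Real.norm_natCast] at h
  rw [div_lt_iff₀ hpos] at hn
  linarith

theorem zero_mem_of_isBounded_polarDual {d : ℕ} {P : Set (Fin d → ℝ)} (hne : P.Nonempty)
    (hconv : Convex ℝ P) (hcl : IsClosed P) (hb : Bornology.IsBounded (polarDual P)) :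
    (0 : Fin d → ℝ) ∈ P := by
  by_contra h0
  obtain ⟨f, u, hu0, hu⟩ := geometric_hahn_banach_point_closed hconv hcl h0
  obtain ⟨a, ha⟩ := exists_dot_eq f
  rw [map_zero] at hu0
  have ha0 : -a = 0 := by
    refine eq_zero_of_forall_nat_smul_mem hb fun n y hy => ?_
    have h1 := hu y hy
    rw [ha] at h1
    have h2 : ∑ i, ((n : ℝ) • -a) i * y i = -((n : ℝ) * ∑ i, a i * y i) := by
      rw [Finset.mul_sum, ← Finset.sum_neg_distrib]
      exact Finset.sum_congr rfl fun i _ => by simp [mul_assoc]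
    rw [h2]
    have : 0 ≤ (n : ℝ) * ∑ i, a i * y i := mul_nonneg n.cast_nonneg (by linarith)
    linarith
  obtain ⟨y, hy⟩ := hne
  have h1 := hu y hy
  rw [ha, neg_eq_zero.mp ha0] at h1
  simp only [Pi.zero_apply, zero_mul, Finset.sum_const_zero] at h1
  linarith

/-- The bipolar theorem. -/
theorem polarDual_polarDual {d : ℕ} {P : Set (Fin d → ℝ)} (h0 : (0 : Fin d → ℝ) ∈ P)
    (hconv : Convex ℝ P) (hcl : IsClosed P) : polarDual (polarDual P) = P := by
  apply Set.Subset.antisymm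
  · intro x hx
    by_contra hxP
    obtain ⟨f, u, hu, hux⟩ := geometric_hahn_banach_closed_point hconv hcl hxP
    obtain ⟨a, ha⟩ := exists_dot_eq f
    have hupos : 0 < u := by simpa using hu 0 h0
    have hpair : ∀ y : Fin d → ℝ, ∑ i, (u⁻¹ • a) i * y i = u⁻¹ * f y := fun y => by
      rw [ha, Finset.mul_sum]
      exact Finset.sum_congr rfl fun i _ => by simp [mul_assoc]
    have hmem : u⁻¹ • a ∈ polarDual P := fun y hy => by
      rw [hpair, inv_mul_le_iff₀ hupos, mul_one]
      exact (hu y hy).le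
    have h1 := hx _ hmem
    simp_rw [mul_comm (x _)] at h1
    rw [hpair, inv_mul_le_iff₀ hupos, mul_one] at h1
    linarith
  · intro x hx y hy
    simp_rw [mul_comm (x _)]
    exact hy x hx

theorem finite_latticePoints {d : ℕ} {K : Set (Fin d → ℝ)} (hK : Bornology.IsBounded K) :
    {x : Fin d → ℤ | (fun i => (x i : ℝ)) ∈ K}.Finite := by
  obtain ⟨C, hC⟩ := hK.exists_norm_le
  refine (Set.finite_Icc (fun _ => -⌈C⌉ : Fin d → ℤ) (fun _ => ⌈C⌉)).subset fun x hx => ?_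
  have h : ∀ i, |(x i : ℝ)| ≤ ⌈C⌉ := fun i =>
    ((norm_le_pi_norm (fun i => (x i : ℝ)) i).trans (hC _ hx)).trans (Int.le_ceil C)
  exact ⟨fun i => by exact_mod_cast (abs_le.mp (h i)).1,
    fun i => by exact_mod_cast (abs_le.mp (h i)).2⟩

/-- If the polar dual has locally constant lattice count between integers, the support function
of `Q` is integral at lattice points. -/
theorem exists_int_eq_of_isMaxOn {d : ℕ} {Q : Set (Fin d → ℝ)} (h0 : (0 : Fin d → ℝ) ∈ Q)
    (hb : Bornology.IsBounded (polarDual Q))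
    (hsemi : ∀ s : ℝ, 0 ≤ s →
      latticeCount (s • polarDual Q) = latticeCount ((⌊s⌋ : ℝ) • polarDual Q))
    (x : Fin d → ℤ) {v : Fin d → ℝ} (hv : v ∈ Q)
    (hmax : ∀ y ∈ Q, ∑ i, (x i : ℝ) * y i ≤ ∑ i, (x i : ℝ) * v i) :
    ∃ n : ℤ, ∑ i, (x i : ℝ) * v i = n := by
  set c := ∑ i, (x i : ℝ) * v i with hc
  have hc0 : 0 ≤ c := by simpa using hmax 0 h0
  rcases hc0.eq_or_lt with h | hpos
  · exact ⟨0, by simp [← h]⟩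
  have hscale : ∀ {s : ℝ} {z y : Fin d → ℝ},
      ∑ i, (s • z) i * y i = s * ∑ i, z i * y i := fun {s z y} => by
    rw [Finset.mul_sum]
    exact Finset.sum_congr rfl fun i _ => by simp [mul_assoc]
  have hxc : (fun i => (x i : ℝ)) ∈ c • polarDual Q := by
    rw [Set.mem_smul_set_iff_inv_smul_mem₀ hpos.ne']
    intro y hy
    rw [hscale, inv_mul_le_iff₀ hpos, mul_one]
    exact hmax y hy
  have hfl : (0 : ℝ) ≤ ⌊c⌋ := by exact_mod_cast Int.floor_nonneg.mpr hc0
  have hsub : (⌊c⌋ : ℝ) • polarDual Q ⊆ c • polarDual Q := by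
    rintro _ ⟨z, hz, rfl⟩
    rw [Set.mem_smul_set_iff_inv_smul_mem₀ hpos.ne']
    intro y hy
    change ∑ i, (c⁻¹ • ((⌊c⌋ : ℝ) • z)) i * y i ≤ 1
    rw [hscale, hscale, inv_mul_le_iff₀ hpos, mul_one]
    exact (mul_le_of_le_one_right hfl (hz y hy)).trans (Int.floor_le c)
  have heq := Set.eq_of_subset_of_ncard_le
    (s := {x : Fin d → ℤ | (fun i => (x i : ℝ)) ∈ (⌊c⌋ : ℝ) • polarDual Q})
    (t := {x : Fin d → ℤ | (fun i => (x i : ℝ)) ∈ c • polarDual Q})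
    (fun x hx => hsub hx) (hsemi c hc0).le (finite_latticePoints (hb.smul₀ c))
  have hxf : x ∈ {x : Fin d → ℤ | (fun i => (x i : ℝ)) ∈ (⌊c⌋ : ℝ) • polarDual Q} := by
    rw [heq]; exact hxc
  obtain ⟨z, hz, hzx⟩ := hxf
  refine ⟨⌊c⌋, le_antisymm ?_ (Int.floor_le c)⟩
  have h1 : c = ⌊c⌋ * ∑ i, z i * v i := by
    rw [← hscale]
    exact Finset.sum_congr rfl fun i _ => by rw [← congrFun hzx i]
  calc c = ⌊c⌋ * ∑ i, z i * v i := h1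
    _ ≤ ⌊c⌋ := mul_le_of_le_one_right hfl (hz v hv)

theorem exists_minimal_convexHull_eq {d : ℕ} (V : Finset (Fin d → ℝ)) :
    ∃ U : Finset (Fin d → ℝ), convexHull ℝ (U : Set (Fin d → ℝ)) = convexHull ℝ ↑V ∧
      ∀ v ∈ U, v ∉ convexHull ℝ ((U.erase v : Finset _) : Set (Fin d → ℝ)) := by
  induction V using Finset.strongInduction with
  | H V ih =>
    by_cases h : ∀ v ∈ V, v ∉ convexHull ℝ ((V.erase v : Finset _) : Set (Fin d → ℝ))
    · exact ⟨V, rfl, h⟩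
    · push Not at h
      obtain ⟨v, hv, hmem⟩ := h
      obtain ⟨U, hU, hmin⟩ := ih _ (Finset.erase_ssubset hv)
      refine ⟨U, hU.trans (Set.Subset.antisymm
        (convexHull_mono (by exact_mod_cast Finset.erase_subset v V)) ?_), hmin⟩
      refine convexHull_min (fun w hw => ?_) (convex_convexHull ℝ _)
      by_cases hwv : w = v
      · exact hwv ▸ hmem
      · exact subset_convexHull ℝ _ (by simpa [hwv] using hw)

/-- A point outside a polytope is separated from it by a lattice direction, with arbitrarily large
gap. -/
theorem exists_lattice_direction {d : ℕ} (U : Finset (Fin d → ℝ)) {v : Fin d → ℝ}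
    (hv : v ∉ convexHull ℝ (U : Set (Fin d → ℝ))) (C : ℝ) :
    ∃ x : Fin d → ℤ, ∀ w ∈ U, C ≤ ∑ i, (x i : ℝ) * (v i - w i) := by
  obtain ⟨f, u, hu, huv⟩ := geometric_hahn_banach_closed_point (convex_convexHull ℝ _)
    (U.finite_toSet.isClosed_convexHull ℝ) hv
  obtain ⟨a, ha⟩ := exists_dot_eq f
  obtain ⟨D, hD⟩ : ∃ D : ℝ, ∀ w ∈ U, ∑ i, |v i - w i| ≤ D :=
    ⟨∑ w ∈ U, ∑ i, |v i - w i|, fun w hw => Finset.single_le_sum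
      (f := fun w => ∑ i, |v i - w i|)
      (fun w _ => Finset.sum_nonneg fun i _ => abs_nonneg _) hw⟩
  have hδ : 0 < f v - u := by linarith
  obtain ⟨N, hN⟩ := exists_nat_gt ((C + D) / (f v - u))
  rw [div_lt_iff₀ hδ] at hN
  refine ⟨fun i => ⌊N * a i⌋, fun w hw => ?_⟩
  have hgap : N * (f v - u) ≤ ∑ i, N * a i * (v i - w i) := by
    have h1 : ∑ i, N * a i * (v i - w i) = N * (f v - f w) := by
      rw [ha, ha, ← Finset.sum_sub_distrib, Finset.mul_sum]
      exact Finset.sum_congr rfl fun i _ => by ring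
    rw [h1]
    have := hu w (subset_convexHull ℝ _ hw)
    gcongr
  have hround : ∑ i, N * a i * (v i - w i) - ∑ i, (⌊N * a i⌋ : ℝ) * (v i - w i)
      ≤ ∑ i, |v i - w i| := by
    rw [← Finset.sum_sub_distrib]
    refine Finset.sum_le_sum fun i _ => ?_
    rw [← sub_mul, Int.self_sub_floor]
    refine (le_abs_self _).trans ?_
    rw [abs_mul, abs_of_nonneg (Int.fract_nonneg _)]
    exact mul_le_of_le_one_left (abs_nonneg _) (Int.fract_lt_one _).le
  linarith [hD w hw]

/-- A polytope whose support function is integral at lattice points is a lattice polytope. -/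
theorem exists_int_vertices {d : ℕ} {Q : Set (Fin d → ℝ)} (V : Finset (Fin d → ℝ))
    (hQ : Q = convexHull ℝ (V : Set (Fin d → ℝ)))
    (hint : ∀ (x : Fin d → ℤ) (v : Fin d → ℝ), v ∈ Q →
      (∀ y ∈ Q, ∑ i, (x i : ℝ) * y i ≤ ∑ i, (x i : ℝ) * v i) →
      ∃ n : ℤ, ∑ i, (x i : ℝ) * v i = n) :
    ∃ W : Finset (Fin d → ℤ),
      Q = convexHull ℝ ((fun v : Fin d → ℤ => fun i => (v i : ℝ)) '' W) := by
  classical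
  obtain ⟨U, hU, hmin⟩ := exists_minimal_convexHull_eq V
  rw [← hU] at hQ
  have hcoord : ∀ v ∈ U, ∃ z : Fin d → ℤ, (fun i => (z i : ℝ)) = v := by
    intro v hv
    have hvQ : v ∈ Q := hQ ▸ subset_convexHull ℝ _ hv
    have hpeak : ∀ x : Fin d → ℤ, (∀ w ∈ U.erase v, 0 ≤ ∑ i, (x i : ℝ) * (v i - w i)) →
        ∃ n : ℤ, ∑ i, (x i : ℝ) * v i = n := by
      intro x hx
      refine hint x v hvQ fun y hy => ?_
      have hlin : IsLinearMap ℝ fun y : Fin d → ℝ => ∑ i, (x i : ℝ) * y i :=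
        ⟨fun a b => by simp [mul_add, Finset.sum_add_distrib],
          fun c a => by simp [Finset.mul_sum, mul_left_comm]⟩
      rw [hQ] at hy
      refine convexHull_min (fun w hw => ?_)
        (convex_halfSpace_le hlin (∑ i, (x i : ℝ) * v i)) hy
      by_cases hwv : w = v
      · simp [hwv]
      · have := hx w (Finset.mem_erase.mpr ⟨hwv, hw⟩)
        simpa [mul_sub, Finset.sum_sub_distrib] using this
    obtain ⟨D, hD⟩ : ∃ D : ℝ, ∀ w ∈ U, ∑ i, |v i - w i| ≤ D :=
      ⟨∑ w ∈ U, ∑ i, |v i - w i|, fun w hw => Finset.single_le_sum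
        (f := fun w => ∑ i, |v i - w i|)
        (fun w _ => Finset.sum_nonneg fun i _ => abs_nonneg _) hw⟩
    obtain ⟨x, hx⟩ := exists_lattice_direction (U.erase v) (hmin v hv) D
    have hxD : ∀ w ∈ U.erase v, ∀ j, |v j - w j| ≤ ∑ i, (x i : ℝ) * (v i - w i) :=
      fun w hw j => (Finset.single_le_sum (f := fun i => |v i - w i|)
        (fun i _ => abs_nonneg _) (Finset.mem_univ j)).trans
        ((hD w (Finset.mem_of_mem_erase hw)).trans (hx w hw))
    have hz : ∀ j, ∃ z : ℤ, (z : ℝ) = v j := by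
      intro j
      have hshift : ∀ y : Fin d → ℝ, ∑ i, ((x + Pi.single j 1 : Fin d → ℤ) i : ℝ) * y i
          = ∑ i, (x i : ℝ) * y i + y j := fun y => by
        simp [add_mul, Finset.sum_add_distrib, Pi.single_apply]
      obtain ⟨n, hn⟩ := hpeak x fun w hw => (abs_nonneg _).trans (hxD w hw j)
      obtain ⟨m, hm⟩ := hpeak (x + Pi.single j 1) fun w hw => by
        rw [hshift fun i => v i - w i]
        linarith [hxD w hw j, neg_abs_le (v j - w j)]
      rw [hshift, hn] at hm
      exact ⟨m - n, by push_cast; linarith⟩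
    choose z hz using hz
    exact ⟨z, funext hz⟩
  choose! g hg using hcoord
  refine ⟨U.image g, ?_⟩
  rw [hQ, Finset.coe_image, Set.image_image, Set.image_congr hg, Set.image_id']

theorem stmt16 {d : ℕ} (P : Set (Fin d → ℝ))
    (hPrat : ∃ V : Finset (Fin d → ℚ),
      P = convexHull ℝ ((fun q : Fin d → ℚ => fun i => (q i : ℝ)) '' V))
    (hDrat : ∃ V : Finset (Fin d → ℚ),
      polarDual P = convexHull ℝ ((fun q : Fin d → ℚ => fun i => (q i : ℝ)) '' V))
    (hPsemi : ∀ s : ℝ, 0 ≤ s →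
      latticeCount (s • P) = latticeCount ((⌊s⌋ : ℝ) • P))
    (hDsemi : ∀ s : ℝ, 0 ≤ s →
      latticeCount (s • polarDual P) = latticeCount ((⌊s⌋ : ℝ) • polarDual P)) :
    (∃ W : Finset (Fin d → ℤ),
        P = convexHull ℝ ((fun v : Fin d → ℤ => fun i => (v i : ℝ)) '' W)) ∧
    (∃ W : Finset (Fin d → ℤ),
        polarDual P = convexHull ℝ ((fun v : Fin d → ℤ => fun i => (v i : ℝ)) '' W)) := by
  classical
  have hfin : ∀ Q : Set (Fin d → ℝ), (∃ V : Finset (Fin d → ℚ),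
      Q = convexHull ℝ ((fun q : Fin d → ℚ => fun i => (q i : ℝ)) '' V)) →
      ∃ V : Finset (Fin d → ℝ), Q = convexHull ℝ (V : Set (Fin d → ℝ)) := by
    rintro Q ⟨V, hV⟩
    exact ⟨V.image fun q i => (q i : ℝ), by rw [hV, Finset.coe_image]⟩
  obtain ⟨V, hV⟩ := hfin P hPrat
  obtain ⟨V', hV'⟩ := hfin _ hDrat
  have hcl : IsClosed P := hV ▸ V.finite_toSet.isClosed_convexHull ℝ
  have hconv : Convex ℝ P := hV ▸ convex_convexHull ℝ _
  have hPb : Bornology.IsBounded P :=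
    hV ▸ (isBounded_convexHull.mpr V.finite_toSet.isBounded)
  have hDb : Bornology.IsBounded (polarDual P) :=
    hV' ▸ (isBounded_convexHull.mpr V'.finite_toSet.isBounded)
  have hD0 : (0 : Fin d → ℝ) ∈ polarDual P := fun y _ => by simp
  rcases P.eq_empty_or_nonempty with hP | hne
  · refine ⟨⟨∅, by simp [hP]⟩, ⟨{0}, ?_⟩⟩
    have : polarDual P = {0} := by
      refine Set.Subset.antisymm (fun x _ => ?_) (by simpa using hD0)
      exact eq_zero_of_forall_nat_smul_mem hDb fun n y hy => by simp [hP] at hy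
    rw [this, Finset.coe_singleton, Set.image_singleton, convexHull_singleton]
    simp [Pi.zero_def]
  · have h0 := zero_mem_of_isBounded_polarDual hne hconv hcl hDb
    have hPP := polarDual_polarDual h0 hconv hcl
    refine ⟨exists_int_vertices V hV fun x v hv hmax =>
        exists_int_eq_of_isMaxOn h0 hDb hDsemi x hv hmax,
      exists_int_vertices V' hV' fun x v hv hmax =>
        exists_int_eq_of_isMaxOn hD0 (by rwa [hPP]) (by rwa [hPP]) x hv hmax⟩
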